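/- arXiv:1212.1884 — 2 statements merged into one kernel-verified Lean document; each statement's English description precedes it below -/
import Mathlib

section
/- There exists a constant C > 0 such that the following holds: for every n ≥ 2, every m ≥ 2, every n-player game 𝒢 in which each player has at most m strategies and every player has a dominant strategy (so that 𝒢 has a dominant profile), and every β ≥ 0, the logit dynamics for 𝒢 with inverse noise β satisfies: for every integer t ≥ C·m^n·n·ln n and every pair of starting profiles x, y, ‖P^t(x,·) − P^t(y,·)‖_TV ≤ 1/4; consequently the mixing time t_mix(1/4) is at most C·m^n·n·ln n, a bound independent of β. -/
noncomputable section

open Finset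

variable {n : ℕ} {S : Fin n → Type*} [∀ i, Fintype (S i)] [∀ i, DecidableEq (S i)]
  [∀ i, Nonempty (S i)]

/-- Logit update probability `σ_i(z ∣ x)` with inverse noise `β` for the game with
utilities `u`. -/
def logitSigma (β : ℝ) (u : Fin n → (∀ i, S i) → ℝ) (i : Fin n) (z : S i)
    (x : ∀ i, S i) : ℝ :=
  Real.exp (β * u i (Function.update x i z)) /
    ∑ w : S i, Real.exp (β * u i (Function.update x i w))

/-- Transition matrix of the logit dynamics with inverse noise `β`:
`P x y = (1/n) · σ_i(y_i ∣ x)` if `x` and `y` differ exactly in coordinate `i`,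
`P x x = (1/n) · ∑ i, σ_i(x_i ∣ x)`, and `P x y = 0` otherwise. -/
def logitP (β : ℝ) (u : Fin n → (∀ i, S i) → ℝ) :
    Matrix (∀ i, S i) (∀ i, S i) ℝ := fun x y =>
  (1 / (n : ℝ)) *
    ∑ i, if y = Function.update x i (y i) then logitSigma β u i (y i) x else 0

/-- `Φ` is an (exact) potential for the game with utilities `u`. -/
def IsPotential (u : Fin n → (∀ i, S i) → ℝ) (Φ : (∀ i, S i) → ℝ) : Prop :=
  ∀ (i : Fin n) (a b : S i) (x : ∀ i, S i),
    u i (Function.update x i a) - u i (Function.update x i b) =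
      Φ (Function.update x i b) - Φ (Function.update x i a)

/-- The Gibbs measure `π(x) = exp(−β·Φ(x))/Z`. -/
def gibbs (β : ℝ) (Φ : (∀ i, S i) → ℝ) (x : ∀ i, S i) : ℝ :=
  Real.exp (-β * Φ x) / ∑ y : ∀ i, S i, Real.exp (-β * Φ y)

/-- Total variation distance `(1/2)·∑ z, |μ z − ν z|`. -/
def tvDist {α : Type*} [Fintype α] (μ ν : α → ℝ) : ℝ :=
  (1 / 2) * ∑ z, |μ z - ν z|

/-- Maximum global variation `ΔΦ = max Φ − min Φ`. -/
def maxVar (Φ : (∀ i, S i) → ℝ) : ℝ :=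
  sSup {d : ℝ | ∃ x y : ∀ i, S i, d = Φ x - Φ y}

/-- Two profiles are adjacent if they differ in exactly one coordinate. -/
def Adjacent (x y : ∀ i, S i) : Prop :=
  (Finset.univ.filter fun i => x i ≠ y i).card = 1

/-- Maximum local variation `δΦ`. -/
def localVar (Φ : (∀ i, S i) → ℝ) : ℝ :=
  sSup {d : ℝ | ∃ x y : ∀ i, S i, Adjacent x y ∧ d = Φ x - Φ y}

set_option linter.unusedSectionVars false

theorem logitSigma_nonneg (β : ℝ) (u : Fin n → (∀ i, S i) → ℝ) (i : Fin n) (z : S i)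
    (x : ∀ i, S i) : 0 ≤ logitSigma β u i z x := by
  unfold logitSigma
  positivity

theorem sum_logitSigma (β : ℝ) (u : Fin n → (∀ i, S i) → ℝ) (i : Fin n) (x : ∀ i, S i) :
    ∑ z, logitSigma β u i z x = 1 := by
  unfold logitSigma
  rw [← Finset.sum_div]
  exact div_self (Finset.sum_pos (fun _ _ => Real.exp_pos _) Finset.univ_nonempty).ne'

/-- A dominant strategy is selected with probability at least `1/m`. -/
theorem inv_le_logitSigma_of_dominant {β : ℝ} (hβ : 0 ≤ β) {u : Fin n → (∀ i, S i) → ℝ}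
    {m : ℕ} (i : Fin n) (hm : Fintype.card (S i) ≤ m) {s : S i} (x : ∀ i, S i)
    (hs : ∀ s' : S i, u i (Function.update x i s') ≤ u i (Function.update x i s)) :
    (m : ℝ)⁻¹ ≤ logitSigma β u i s x := by
  have hm0 : (0 : ℝ) < m := by exact_mod_cast Fintype.card_pos.trans_le hm
  unfold logitSigma
  rw [le_div_iff₀ (Finset.sum_pos (fun _ _ => Real.exp_pos _) Finset.univ_nonempty),
    inv_mul_le_iff₀ hm0]
  calc ∑ w : S i, Real.exp (β * u i (Function.update x i w))
      ≤ ∑ _w : S i, Real.exp (β * u i (Function.update x i s)) := by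
        gcongr with w
        exact hs w
    _ = Fintype.card (S i) * Real.exp (β * u i (Function.update x i s)) := by simp
    _ ≤ m * Real.exp (β * u i (Function.update x i s)) := by gcongr

theorem logitP_mulVec (β : ℝ) (u : Fin n → (∀ i, S i) → ℝ) (f : (∀ i, S i) → ℝ)
    (x : ∀ i, S i) :
    (logitP β u).mulVec f x =
      (1 / (n : ℝ)) * ∑ i, ∑ z, logitSigma β u i z x * f (Function.update x i z) := by
  simp only [Matrix.mulVec, dotProduct, logitP, mul_assoc, ← Finset.mul_sum, Finset.sum_mul]
  rw [Finset.sum_comm]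
  congr 1
  refine Finset.sum_congr rfl fun i _ => ?_
  simp only [ite_mul, zero_mul]
  rw [← Finset.sum_filter]
  refine Finset.sum_bij' (fun y _ => y i) (fun z _ => Function.update x i z) ?_ ?_ ?_ ?_ ?_
  · simp
  · simp
  · intro y hy
    exact (Finset.mem_filter.1 hy).2.symm
  · simp
  · intro y hy
    rw [← (Finset.mem_filter.1 hy).2]

theorem logitP_nonneg (β : ℝ) (u : Fin n → (∀ i, S i) → ℝ) (x y : ∀ i, S i) :
    0 ≤ logitP β u x y := by
  unfold logitP
  refine mul_nonneg (by positivity) (Finset.sum_nonneg fun i _ => ?_)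
  split_ifs
  exacts [logitSigma_nonneg _ _ _ _ _, le_rfl]

theorem logitP_mem_rowStochastic (hn : n ≠ 0) (β : ℝ) (u : Fin n → (∀ i, S i) → ℝ) :
    logitP β u ∈ Matrix.rowStochastic ℝ (∀ i, S i) := by
  refine ⟨logitP_nonneg β u, ?_⟩
  ext x
  rw [logitP_mulVec]
  simp [sum_logitSigma, hn]

/-- Indicator of the profiles that agree with `s` on the players in `A`. -/
def agreeIndicator (s : ∀ i, S i) (A : Finset (Fin n)) (x : ∀ i, S i) : ℝ :=
  if ∀ j ∈ A, x j = s j then 1 else 0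

/-- One step of the logit dynamics: a selected player of `A` adopts its dominant strategy
with probability at least `1/m`, and is then no longer constrained at earlier times. -/
theorem le_logitP_mulVec_agreeIndicator {β : ℝ} (hβ : 0 ≤ β) {u : Fin n → (∀ i, S i) → ℝ}
    {m : ℕ} (hm : ∀ i, Fintype.card (S i) ≤ m) {s : ∀ i, S i}
    (hs : ∀ (i : Fin n) (s' : S i) (x : ∀ j, S j),
      u i (Function.update x i s') ≤ u i (Function.update x i (s i)))
    (A : Finset (Fin n)) (x : ∀ i, S i) :
    (1 / (n : ℝ)) * ∑ i, (if i ∈ A then (m : ℝ)⁻¹ * agreeIndicator s (A.erase i) x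
        else agreeIndicator s A x) ≤
      (logitP β u).mulVec (agreeIndicator s A) x := by
  rw [logitP_mulVec]
  gcongr with i
  have hnonneg : ∀ (B : Finset (Fin n)) (y : ∀ i, S i), 0 ≤ agreeIndicator s B y := by
    intro B y
    unfold agreeIndicator
    split_ifs <;> norm_num
  split_ifs with hi
  · have hupd : agreeIndicator s A (Function.update x i (s i)) =
        agreeIndicator s (A.erase i) x := by
      unfold agreeIndicator
      congr 1
      refine propext ⟨fun h j hj => ?_, fun h j hj => ?_⟩
      · have := h j (Finset.mem_of_mem_erase hj)
        rwa [Function.update_of_ne (Finset.ne_of_mem_erase hj)] at this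
      · rcases eq_or_ne j i with rfl | hne
        · simp
        · rw [Function.update_of_ne hne]
          exact h j (Finset.mem_erase.2 ⟨hne, hj⟩)
    calc (m : ℝ)⁻¹ * agreeIndicator s (A.erase i) x
        ≤ logitSigma β u i (s i) x * agreeIndicator s (A.erase i) x :=
          mul_le_mul_of_nonneg_right
            (inv_le_logitSigma_of_dominant hβ i (hm i) x fun s' => hs i s' x) (hnonneg _ _)
      _ = logitSigma β u i (s i) x * agreeIndicator s A (Function.update x i (s i)) := by
          rw [hupd]
      _ ≤ _ := Finset.single_le_sum
          (f := fun z => logitSigma β u i z x * agreeIndicator s A (Function.update x i z))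
          (fun z _ => mul_nonneg (logitSigma_nonneg _ _ _ _ _) (hnonneg _ _))
          (Finset.mem_univ (s i))
  · have hupd : ∀ z, agreeIndicator s A (Function.update x i z) = agreeIndicator s A x := by
      intro z
      unfold agreeIndicator
      congr 1
      refine propext (forall₂_congr fun j hj => ?_)
      rw [Function.update_of_ne (ne_of_mem_of_not_mem hj hi)]
    simp only [hupd, ← Finset.sum_mul, sum_logitSigma, one_mul, le_refl]

/-- A coupon-collector lower bound for the probability that the players in `A` all play
their dominant strategy at time `t`. -/
theorem le_logitP_pow_mulVec_agreeIndicator (hn : n ≠ 0) {β : ℝ} (hβ : 0 ≤ β)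
    {u : Fin n → (∀ i, S i) → ℝ} {m : ℕ} (hm : ∀ i, Fintype.card (S i) ≤ m)
    {s : ∀ i, S i}
    (hs : ∀ (i : Fin n) (s' : S i) (x : ∀ j, S j),
      u i (Function.update x i s') ≤ u i (Function.update x i (s i)))
    (t : ℕ) (A : Finset (Fin n)) (x : ∀ i, S i) :
    (m : ℝ)⁻¹ ^ #A * (1 - #A * (1 - 1 / (n : ℝ)) ^ t) ≤
      (logitP β u ^ t).mulVec (agreeIndicator s A) x := by
  induction t generalizing A with
  | zero =>
    rw [pow_zero, pow_zero, Matrix.one_mulVec, mul_one]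
    unfold agreeIndicator
    rcases A.eq_empty_or_nonempty with rfl | hA
    · simp
    · have h1 : (1 : ℝ) ≤ #A := by exact_mod_cast hA.card_pos
      refine (mul_nonpos_of_nonneg_of_nonpos (by positivity) (by linarith)).trans ?_
      split_ifs <;> norm_num
  | succ t ih =>
    have hn0 : (n : ℝ) ≠ 0 := by exact_mod_cast hn
    have hpow : ∀ y, 0 ≤ (logitP β u ^ t) x y :=
      (pow_mem (logitP_mem_rowStochastic hn β u) t).1 x
    set r : ℝ := (1 - 1 / (n : ℝ)) ^ t with hr
    have hcard : #(Finset.univ.filter fun i => i ∉ A) = n - #A := by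
      rw [← Finset.compl_filter, Finset.card_compl]
      simp
    have hA : #A ≤ n := by simpa using Finset.card_le_univ A
    calc (m : ℝ)⁻¹ ^ #A * (1 - #A * (1 - 1 / (n : ℝ)) ^ (t + 1))
        = (1 / (n : ℝ)) * ∑ i, (if i ∈ A then
            (m : ℝ)⁻¹ * ((m : ℝ)⁻¹ ^ (#A - 1) * (1 - (#A - 1) * r))
            else (m : ℝ)⁻¹ ^ #A * (1 - #A * r)) := by
          rw [Finset.sum_ite, Finset.sum_const, Finset.sum_const, hcard, nsmul_eq_mul,
            nsmul_eq_mul, Nat.cast_sub hA, Finset.filter_univ_mem, pow_succ, ← hr]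
          rcases A.eq_empty_or_nonempty with rfl | hne
          · simp [hn0]
          · rw [← mul_assoc (m : ℝ)⁻¹, ← pow_succ', Nat.sub_add_cancel hne.card_pos]
            field_simp
            ring
      _ ≤ (1 / (n : ℝ)) * ∑ i, (if i ∈ A then
            (m : ℝ)⁻¹ * (logitP β u ^ t).mulVec (agreeIndicator s (A.erase i)) x
            else (logitP β u ^ t).mulVec (agreeIndicator s A) x) := by
          gcongr with i
          split_ifs with hi
          · have := ih (A.erase i)
            rw [Finset.card_erase_of_mem hi,
              Nat.cast_sub (Finset.card_pos.2 ⟨i, hi⟩), Nat.cast_one] at this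
            gcongr
          · exact ih A
      _ = (logitP β u ^ t).mulVec (fun y => (1 / (n : ℝ)) *
            ∑ i, (if i ∈ A then (m : ℝ)⁻¹ * agreeIndicator s (A.erase i) y
              else agreeIndicator s A y)) x := by
          simp only [Matrix.mulVec, dotProduct, Finset.mul_sum]
          rw [Finset.sum_comm]
          refine Finset.sum_congr rfl fun i _ => ?_
          split_ifs
          all_goals
            simp only [Finset.mul_sum]
            refine Finset.sum_congr rfl fun y _ => ?_
            ring
      _ ≤ (logitP β u ^ t).mulVec ((logitP β u).mulVec (agreeIndicator s A)) x := by
          refine Finset.sum_le_sum fun y _ => mul_le_mul_of_nonneg_left ?_ (hpow y)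
          exact le_logitP_mulVec_agreeIndicator hβ hm hs A y
      _ = _ := by rw [Matrix.mulVec_mulVec, ← pow_succ]

theorem le_logitP_pow_dominant (hn : n ≠ 0) {β : ℝ} (hβ : 0 ≤ β)
    {u : Fin n → (∀ i, S i) → ℝ} {m : ℕ} (hm : ∀ i, Fintype.card (S i) ≤ m)
    {s : ∀ i, S i}
    (hs : ∀ (i : Fin n) (s' : S i) (x : ∀ j, S j),
      u i (Function.update x i s') ≤ u i (Function.update x i (s i)))
    (t : ℕ) (x : ∀ i, S i) :
    (m : ℝ)⁻¹ ^ n * (1 - n * (1 - 1 / (n : ℝ)) ^ t) ≤ (logitP β u ^ t) x s := by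
  have h := le_logitP_pow_mulVec_agreeIndicator hn hβ hm hs t Finset.univ x
  have hind : agreeIndicator s Finset.univ = Pi.single s (1 : ℝ) := by
    ext y
    simp [agreeIndicator, Pi.single_apply, funext_iff]
  rw [hind, Matrix.mulVec_single_one] at h
  simpa using h

/-- Doeblin contraction: if every row of a stochastic matrix gives mass at least `δ` to a
fixed state, the matrix contracts the `ℓ¹` norm of signed measures of total mass zero. -/
theorem sum_abs_vecMul_le {α : Type*} [Fintype α] [DecidableEq α] {Q : Matrix α α ℝ}
    (hQ : Q ∈ Matrix.rowStochastic ℝ α) {s : α} {δ : ℝ} (hδ : ∀ x, δ ≤ Q x s)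
    {d : α → ℝ} (hd : ∑ w, d w = 0) :
    ∑ z, |Matrix.vecMul d Q z| ≤ (1 - δ) * ∑ w, |d w| := by
  have hrow : ∀ w, ∑ z, Q w z = 1 := fun w => Matrix.sum_row_of_mem_rowStochastic hQ w
  have hnonneg : ∀ w z, 0 ≤ Q w z - (Pi.single s δ : α → ℝ) z := by
    intro w z
    rcases eq_or_ne z s with rfl | hz
    · simpa using hδ w
    · simpa [hz] using hQ.1 w z
  calc ∑ z, |Matrix.vecMul d Q z|
      = ∑ z, |∑ w, d w * (Q w z - (Pi.single s δ : α → ℝ) z)| := by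
        refine Finset.sum_congr rfl fun z _ => ?_
        simp only [mul_sub, Finset.sum_sub_distrib, ← Finset.sum_mul, hd, zero_mul, sub_zero]
        rfl
    _ ≤ ∑ z, ∑ w, |d w| * (Q w z - (Pi.single s δ : α → ℝ) z) := by
        refine Finset.sum_le_sum fun z _ => (Finset.abs_sum_le_sum_abs _ _).trans_eq ?_
        refine Finset.sum_congr rfl fun w _ => ?_
        rw [abs_mul, abs_of_nonneg (hnonneg w z)]
    _ = (1 - δ) * ∑ w, |d w| := by
        rw [Finset.sum_comm, Finset.mul_sum]
        refine Finset.sum_congr rfl fun w _ => ?_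
        rw [← Finset.mul_sum, Finset.sum_sub_distrib, hrow, Finset.sum_pi_single']
        simp [mul_comm]

theorem sum_vecMul_of_mem_rowStochastic {α : Type*} [Fintype α] [DecidableEq α]
    {Q : Matrix α α ℝ} (hQ : Q ∈ Matrix.rowStochastic ℝ α) (d : α → ℝ) :
    ∑ z, Matrix.vecMul d Q z = ∑ w, d w := by
  simp only [Matrix.vecMul, dotProduct]
  rw [Finset.sum_comm]
  simp only [← Finset.mul_sum, Matrix.sum_row_of_mem_rowStochastic hQ, mul_one]

theorem sum_abs_vecMul_pow_le {α : Type*} [Fintype α] [DecidableEq α] {Q : Matrix α α ℝ}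
    (hQ : Q ∈ Matrix.rowStochastic ℝ α) {s : α} {δ : ℝ} (hδ1 : δ ≤ 1) (hδ : ∀ x, δ ≤ Q x s)
    {d : α → ℝ} (hd : ∑ w, d w = 0) (k : ℕ) :
    ∑ z, |Matrix.vecMul d (Q ^ k) z| ≤ (1 - δ) ^ k * ∑ w, |d w| := by
  induction k with
  | zero => simp
  | succ k ih =>
    have hk : ∑ z, Matrix.vecMul d (Q ^ k) z = 0 := by
      rw [sum_vecMul_of_mem_rowStochastic (pow_mem hQ k), hd]
    rw [pow_succ, ← Matrix.vecMul_vecMul, pow_succ', mul_assoc]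
    exact (sum_abs_vecMul_le hQ hδ hk).trans
      (mul_le_mul_of_nonneg_left ih (sub_nonneg.2 hδ1))

/-- If the `T`-step chain gives mass at least `δ` to a fixed state from every start, then
two initial distributions are at distance at most `exp (-δ * k)` after `k` blocks of `T`
steps. -/
theorem tvDist_vecMul_pow_le {α : Type*} [Fintype α] [DecidableEq α] {P : Matrix α α ℝ}
    (hP : P ∈ Matrix.rowStochastic ℝ α) {s : α} {δ : ℝ} {T : ℕ}
    (hδ : ∀ x, δ ≤ (P ^ T) x s) {k t : ℕ} (ht : T * k ≤ t) {μ ν : α → ℝ}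
    (hμ0 : ∀ z, 0 ≤ μ z) (hμ : ∑ z, μ z = 1) (hν0 : ∀ z, 0 ≤ ν z) (hν : ∑ z, ν z = 1) :
    tvDist (Matrix.vecMul μ (P ^ t)) (Matrix.vecMul ν (P ^ t)) ≤ Real.exp (-δ * k) := by
  obtain ⟨r, rfl⟩ := Nat.exists_eq_add_of_le ht
  have hδ1 : δ ≤ 1 := (hδ s).trans
    (Matrix.le_one_of_mem_rowStochastic (pow_mem hP T))
  have hd : ∑ w, (μ - ν) w = 0 := by simp [hμ, hν]
  have hdk : ∑ z, Matrix.vecMul (μ - ν) (P ^ (T * k)) z = 0 := by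
    rw [sum_vecMul_of_mem_rowStochastic (pow_mem hP _), hd]
  have htwo : ∑ w, |(μ - ν) w| ≤ 2 := by
    calc ∑ w, |(μ - ν) w| ≤ ∑ w, (μ w + ν w) := by
          refine Finset.sum_le_sum fun w _ => abs_le.2 ⟨?_, ?_⟩ <;>
            simp only [Pi.sub_apply] <;> linarith [hμ0 w, hν0 w]
      _ = 2 := by rw [Finset.sum_add_distrib, hμ, hν]; norm_num
  have hmain : ∑ z, |Matrix.vecMul (μ - ν) (P ^ (T * k + r)) z| ≤ (1 - δ) ^ k * 2 := by
    calc ∑ z, |Matrix.vecMul (μ - ν) (P ^ (T * k + r)) z|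
        = ∑ z, |Matrix.vecMul (Matrix.vecMul (μ - ν) (P ^ (T * k))) (P ^ r) z| := by
          rw [Matrix.vecMul_vecMul, pow_add]
      _ ≤ (1 - 0) * ∑ z, |Matrix.vecMul (μ - ν) (P ^ (T * k)) z| :=
          sum_abs_vecMul_le (s := s) (pow_mem hP r) (fun x => (pow_mem hP r).1 x s) hdk
      _ ≤ (1 - δ) ^ k * ∑ w, |(μ - ν) w| := by
          rw [sub_zero, one_mul, pow_mul]
          exact sum_abs_vecMul_pow_le (pow_mem hP T) hδ1 hδ hd k
      _ ≤ (1 - δ) ^ k * 2 :=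
          mul_le_mul_of_nonneg_left htwo (pow_nonneg (sub_nonneg.2 hδ1) k)
  have hexp : (1 - δ) ^ k ≤ Real.exp (-δ * k) := by
    rw [mul_comm, Real.exp_nat_mul]
    exact pow_le_pow_left₀ (sub_nonneg.2 hδ1) (Real.one_sub_le_exp_neg δ) k
  rw [Matrix.sub_vecMul] at hmain
  unfold tvDist
  simp only [Pi.sub_apply] at hmain
  linarith

theorem vecMul_pow_eq_self {α : Type*} [Fintype α] [DecidableEq α] {P : Matrix α α ℝ}
    {μ : α → ℝ} (h : Matrix.vecMul μ P = μ) (t : ℕ) : Matrix.vecMul μ (P ^ t) = μ := by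
  induction t with
  | zero => simp
  | succ t ih => rw [pow_succ, ← Matrix.vecMul_vecMul, ih, h]

theorem exists_nat_between_mul_log {n : ℕ} (hn : 2 ≤ n) :
    ∃ T : ℕ, 2 * (n * Real.log n) ≤ T ∧ (T : ℝ) ≤ 3 * (n * Real.log n) := by
  have hn' : (2 : ℝ) ≤ n := by exact_mod_cast hn
  have hlog : Real.log 2 ≤ Real.log n := Real.log_le_log (by norm_num) hn'
  have hL : 1 ≤ n * Real.log n := by nlinarith [Real.log_two_gt_d9]
  exact ⟨⌈2 * (n * Real.log n)⌉₊, Nat.le_ceil _, by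
    linarith [Nat.ceil_lt_add_one (a := 2 * (n * Real.log n)) (by linarith)]⟩

theorem mul_one_sub_inv_pow_le_half {n T : ℕ} (hn : 2 ≤ n)
    (hT : 2 * (n * Real.log n) ≤ T) : n * (1 - 1 / (n : ℝ)) ^ T ≤ 1 / 2 := by
  have hn' : (2 : ℝ) ≤ n := by exact_mod_cast hn
  have hn0 : (0 : ℝ) < n := by linarith
  have hinv : 1 / (n : ℝ) ≤ 1 := (div_le_one hn0).2 (by linarith)
  have hpow : (1 - 1 / (n : ℝ)) ^ T ≤ ((n : ℝ) ^ 2)⁻¹ := by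
    calc (1 - 1 / (n : ℝ)) ^ T ≤ Real.exp (-(1 / (n : ℝ))) ^ T :=
          pow_le_pow_left₀ (sub_nonneg.2 hinv) (Real.one_sub_le_exp_neg _) T
      _ = Real.exp (-(T / n)) := by rw [← Real.exp_nat_mul]; congr 1; ring
      _ ≤ Real.exp (-(2 * Real.log n)) := by
          gcongr
          rw [le_div_iff₀ hn0]
          linarith
      _ = ((n : ℝ) ^ 2)⁻¹ := by
          rw [Real.exp_neg, two_mul, Real.exp_add, Real.exp_log hn0, sq]
  calc n * (1 - 1 / (n : ℝ)) ^ T ≤ n * ((n : ℝ) ^ 2)⁻¹ := by gcongr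
    _ = 1 / n := by field_simp
    _ ≤ 1 / 2 := by gcongr

/-- There is an absolute constant `C > 0` such that for every `n ≥ 2`,
`m ≥ 2`, every `n`-player game with at most `m` strategies per player in which every
player has a dominant strategy, and every `β ≥ 0`: for every integer
`t ≥ C·m^n·n·ln n` and all starting profiles `x, y`, the distributions of the logit
dynamics at time `t` started from `x` and from `y` are within total variation distance
`1/4`; consequently the chain is within distance `1/4` of its (unique) stationary
distribution, a bound independent of `β`. -/
theorem dominant_strategies_mixing_independent_of_beta :
    ∃ C : ℝ, 0 < C ∧
      ∀ (n m : ℕ), 2 ≤ n → 2 ≤ m →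
      ∀ (S : Fin n → Type) [∀ i, Fintype (S i)] [∀ i, DecidableEq (S i)]
        [∀ i, Nonempty (S i)],
      ∀ u : Fin n → (∀ i, S i) → ℝ,
      (∀ i, Fintype.card (S i) ≤ m) →
      (∀ i : Fin n, ∃ s : S i, ∀ (s' : S i) (x : ∀ j, S j),
          u i (Function.update x i s') ≤ u i (Function.update x i s)) →
      ∀ β : ℝ, 0 ≤ β →
      ∀ t : ℕ, C * (m : ℝ) ^ n * (n : ℝ) * Real.log (n : ℝ) ≤ (t : ℝ) →
      ∀ x y : ∀ i, S i,
        tvDist ((logitP β u ^ t) x) ((logitP β u ^ t) y) ≤ 1 / 4 ∧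
        (∀ μ : (∀ i, S i) → ℝ, (∀ z, 0 ≤ μ z) → (∑ z, μ z) = 1 →
          (∀ z, ∑ w, μ w * logitP β u w z = μ z) →
          tvDist ((logitP β u ^ t) x) μ ≤ 1 / 4) := by
  refine ⟨12, by norm_num, ?_⟩
  intro n m hn hm S _ _ _ u hcard hdom β hβ t ht x y
  choose s hs using hdom
  have hn0 : n ≠ 0 := by omega
  have hP := logitP_mem_rowStochastic hn0 β u
  obtain ⟨T, hT, hT'⟩ := exists_nat_between_mul_log hn
  have hm0 : (0 : ℝ) < (m : ℝ) ^ n := by positivity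
  have hδ : ∀ z, (m : ℝ)⁻¹ ^ n * (1 / 2) ≤ (logitP β u ^ T) z s := fun z =>
    (mul_le_mul_of_nonneg_left (by linarith [mul_one_sub_inv_pow_le_half hn hT])
      (by positivity)).trans (le_logitP_pow_dominant hn0 hβ hcard hs T z)
  have hk : T * (4 * m ^ n) ≤ t := by
    have : (T : ℝ) * (4 * (m : ℝ) ^ n) ≤ t := by nlinarith
    exact_mod_cast this
  have hexp : Real.exp (-((m : ℝ)⁻¹ ^ n * (1 / 2)) * (4 * m ^ n : ℕ)) ≤ 1 / 4 := by
    have heq : -((m : ℝ)⁻¹ ^ n * (1 / 2)) * (4 * m ^ n : ℕ) = -2 := by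
      push_cast
      rw [inv_pow]
      field_simp
      norm_num
    rw [heq, Real.exp_neg, one_div]
    apply inv_anti₀ (by norm_num)
    have h1 := Real.exp_one_gt_d9
    rw [show (2 : ℝ) = 1 + 1 by norm_num, Real.exp_add]
    nlinarith
  have hrow : ∀ z : ∀ i, S i,
      Matrix.vecMul (Pi.single z 1) (logitP β u ^ t) = (logitP β u ^ t) z :=
    fun z => Matrix.single_one_vecMul z _
  have hnonneg : ∀ z w : ∀ i, S i, (0 : ℝ) ≤ (Pi.single z 1 : (∀ i, S i) → ℝ) w :=
    by
    intro z w
    rw [Pi.single_apply]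
    split_ifs <;> norm_num
  have hsum : ∀ z : ∀ i, S i, ∑ w, (Pi.single z 1 : (∀ i, S i) → ℝ) w = 1 := by simp
  refine ⟨?_, fun μ hμ0 hμ hstat => ?_⟩
  · rw [← hrow x, ← hrow y]
    exact (tvDist_vecMul_pow_le hP hδ hk (hnonneg x) (hsum x) (hnonneg y) (hsum y)).trans hexp
  · rw [← hrow x, ← vecMul_pow_eq_self (funext hstat) t]
    exact (tvDist_vecMul_pow_le hP hδ hk (hnonneg x) (hsum x) hμ0 hμ).trans hexp
end
end

section
/- Let 𝒢 be an n-player graphical coordination game on a graph G = (V,E) with parameters δ₀ ≥ δ₁ > 0, and let χ(G) be the cutwidth of G. Then the logit dynamics for 𝒢 with inverse noise β ≥ 0 satisfies: for every ε ∈ (0,1) and every integer t ≥ 2·n²·e^{χ(G)·(δ₀+δ₁)·β}·(ln(1/ε) + n·(n·δ₀·β + 1)), ‖P^t(x,·) − π‖_TV ≤ ε for every starting profile x ∈ {0,1}^V. In particular the mixing time satisfies t_mix(1/4) ≤ 2·n³·e^{χ(G)·(δ₀+δ₁)·β}·(n·δ₀·β + 1) up to an absolute constant factor. -/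
noncomputable section

open Finset

/-- Edge potential of the basic 2×2 coordination game:
`φ(0,0) = −δ₀`, `φ(1,1) = −δ₁`, `φ(0,1) = φ(1,0) = 0`. -/
def coordPhi (δ0 δ1 : ℝ) (a b : Bool) : ℝ :=
  if a = false ∧ b = false then -δ0 else if a = true ∧ b = true then -δ1 else 0

/-- Potential of the graphical coordination game on the (oriented) edge set `E`:
`Φ(x) = ∑_{(u,v) ∈ E} φ(x_u, x_v)`. -/
def graphPot {n : ℕ} (E : Finset (Fin n × Fin n)) (δ0 δ1 : ℝ) (x : Fin n → Bool) : ℝ :=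
  ∑ e ∈ E, coordPhi δ0 δ1 (x e.1) (x e.2)

/-- Gibbs measure `π(x) = exp(−β·Φ(x))/Z` on `{0,1}^n`. -/
def gibbsB {n : ℕ} (β : ℝ) (Φ : (Fin n → Bool) → ℝ) (x : Fin n → Bool) : ℝ :=
  Real.exp (-β * Φ x) / ∑ y : Fin n → Bool, Real.exp (-β * Φ y)

/-- Logit update probability expressed via the potential:
`σ_i(z ∣ x) = exp(−β·Φ(z,x_{−i})) / ∑_{w∈{0,1}} exp(−β·Φ(w,x_{−i}))`. -/
def sigmaB {n : ℕ} (β : ℝ) (Φ : (Fin n → Bool) → ℝ) (i : Fin n) (z : Bool)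
    (x : Fin n → Bool) : ℝ :=
  Real.exp (-β * Φ (Function.update x i z)) /
    ∑ w : Bool, Real.exp (-β * Φ (Function.update x i w))

/-- Transition matrix of the logit dynamics with inverse noise `β` on `{0,1}^n`. -/
def logitPB {n : ℕ} (β : ℝ) (Φ : (Fin n → Bool) → ℝ) :
    Matrix (Fin n → Bool) (Fin n → Bool) ℝ := fun x y =>
  (1 / (n : ℝ)) *
    ∑ i, if y = Function.update x i (y i) then sigmaB β Φ i (y i) x else 0

/-- The set of edges of `E` crossed by position `i` under the ordering `ℓ`
(an edge crosses `i` if one endpoint is placed at or before `i` and the other strictly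
after `i` in the ordering). -/
def crossEdges {n : ℕ} (E : Finset (Fin n × Fin n)) (ℓ : Equiv.Perm (Fin n))
    (i : Fin n) : Finset (Fin n × Fin n) :=
  E.filter fun e => min (ℓ e.1) (ℓ e.2) ≤ ℓ i ∧ ℓ i < max (ℓ e.1) (ℓ e.2)

/-- The cutwidth of the graph with edge set `E`: the minimum over orderings of the
maximum number of crossing edges. -/
def cutwidth {n : ℕ} (E : Finset (Fin n × Fin n)) : ℕ :=
  Finset.inf' Finset.univ ⟨Equiv.refl (Fin n), Finset.mem_univ _⟩
    fun ℓ : Equiv.Perm (Fin n) => Finset.univ.sup fun i => (crossEdges E ℓ i).card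

/-- The profile obtained from `x` by switching the strategy of player `i`. -/
def flipAt {n : ℕ} (i : Fin n) (x : Fin n → Bool) : Fin n → Bool :=
  Function.update x i (!x i)

theorem flipAt_flipAt {n : ℕ} (i : Fin n) (x : Fin n → Bool) :
    flipAt i (flipAt i x) = x := by
  simp [flipAt]

theorem flipAt_apply_self {n : ℕ} (i : Fin n) (x : Fin n → Bool) :
    flipAt i x i = !x i := by
  simp [flipAt]

theorem sum_comp_flipAt {n : ℕ} (i : Fin n) (F : (Fin n → Bool) → ℝ) :
    ∑ x, F (flipAt i x) = ∑ x, F x :=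
  Equiv.sum_comp (Function.Involutive.toPerm (flipAt i) (flipAt_flipAt i)) F

/-- Two functions have the same sum if they agree after symmetrization under `flipAt i`. -/
theorem sum_eq_sum_of_flipAt {n : ℕ} (i : Fin n) {F G : (Fin n → Bool) → ℝ}
    (h : ∀ x, F x + F (flipAt i x) = G x + G (flipAt i x)) :
    ∑ x, F x = ∑ x, G x := by
  have h2 : ∑ x, (F x + F (flipAt i x)) = ∑ x, (G x + G (flipAt i x)) :=
    Finset.sum_congr rfl fun x _ => h x
  rw [Finset.sum_add_distrib, Finset.sum_add_distrib, sum_comp_flipAt, sum_comp_flipAt] at h2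
  linarith

theorem sum_bool_update {n : ℕ} (i : Fin n) (x : Fin n → Bool) (F : (Fin n → Bool) → ℝ) :
    ∑ z : Bool, F (Function.update x i z) = F x + F (flipAt i x) := by
  have hx : Function.update x i (x i) = x := Function.update_eq_self i x
  rw [Fintype.sum_bool, flipAt]
  cases h : x i <;> rw [h] at hx <;> simp [hx, add_comm]

/-- Conditional expectation of `f` when player `i` resamples her strategy according to `π`. -/
def heatBath {n : ℕ} (π : (Fin n → Bool) → ℝ) (i : Fin n) (f : (Fin n → Bool) → ℝ)
    (x : Fin n → Bool) : ℝ :=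
  (π x * f x + π (flipAt i x) * f (flipAt i x)) / (π x + π (flipAt i x))

/-- Ergodic flow between `x` and `flipAt i x` when player `i` is selected. -/
def flow {n : ℕ} (π : (Fin n → Bool) → ℝ) (i : Fin n) (x : Fin n → Bool) : ℝ :=
  π x * π (flipAt i x) / (π x + π (flipAt i x))

/-- Average of the single-player resampling operators. -/
def glauber {n : ℕ} (π : (Fin n → Bool) → ℝ) (f : (Fin n → Bool) → ℝ)
    (x : Fin n → Bool) : ℝ :=
  (1 / (n : ℝ)) * ∑ i, heatBath π i f x

section Reversible

variable {n : ℕ} {π : (Fin n → Bool) → ℝ}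

theorem sum_mul_heatBath_sq (hπ : ∀ x, 0 < π x) (i : Fin n) (f : (Fin n → Bool) → ℝ) :
    ∑ x, π x * heatBath π i f x ^ 2 =
      ∑ x, π x * f x ^ 2 - 1 / 2 * ∑ x, flow π i x * (f x - f (flipAt i x)) ^ 2 := by
  rw [Finset.mul_sum, ← Finset.sum_sub_distrib]
  refine sum_eq_sum_of_flipAt i fun x => ?_
  have h1 := hπ x
  have h2 := hπ (flipAt i x)
  have h3 : π x + π (flipAt i x) ≠ 0 := by positivity
  have h4 : π (flipAt i x) + π x ≠ 0 := by positivity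
  simp only [heatBath, flow, flipAt_flipAt]
  rw [add_comm (π (flipAt i x)) (π x)]
  field_simp
  ring

theorem sum_mul_heatBath_mul (hπ : ∀ x, 0 < π x) (i : Fin n) (f g : (Fin n → Bool) → ℝ) :
    ∑ x, π x * (heatBath π i f x * g x) = ∑ x, π x * (f x * heatBath π i g x) := by
  refine sum_eq_sum_of_flipAt i fun x => ?_
  have h1 := hπ x
  have h2 := hπ (flipAt i x)
  have h3 : π x + π (flipAt i x) ≠ 0 := by positivity
  simp only [heatBath, flipAt_flipAt]
  rw [add_comm (π (flipAt i x)) (π x)]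
  field_simp
  ring

theorem glauber_one (hn : 1 ≤ n) (hπ : ∀ x, 0 < π x) : glauber π (fun _ => 1) = fun _ => 1 := by
  funext x
  have hn' : (n : ℝ) ≠ 0 := by positivity
  have h : ∀ i, heatBath π i (fun _ => 1) x = 1 := fun i => by
    have h1 := hπ x
    have h2 := hπ (flipAt i x)
    simp only [heatBath, mul_one]
    exact div_self (by positivity)
  simp [glauber, h, hn']

theorem glauber_sub (f g : (Fin n → Bool) → ℝ) :
    glauber π (f - g) = glauber π f - glauber π g := by
  funext x
  simp only [glauber, heatBath, Pi.sub_apply, ← mul_sub, ← Finset.sum_sub_distrib]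
  congr 1
  refine Finset.sum_congr rfl fun i _ => ?_
  ring

theorem sum_mul_glauber_mul (hπ : ∀ x, 0 < π x) (f g : (Fin n → Bool) → ℝ) :
    ∑ x, π x * (glauber π f x * g x) = ∑ x, π x * (f x * glauber π g x) := by
  have h : ∀ F G : (Fin n → Bool) → ℝ, ∑ x, π x * (glauber π F x * G x) =
      (1 / (n : ℝ)) * ∑ i, ∑ x, π x * (heatBath π i F x * G x) := fun F G => by
    rw [Finset.sum_comm, Finset.mul_sum]
    refine Finset.sum_congr rfl fun x _ => ?_
    rw [glauber, ← Finset.mul_sum, ← Finset.sum_mul]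
    ring
  have h' : ∑ x, π x * (f x * glauber π g x) = ∑ x, π x * (glauber π g x * f x) :=
    Finset.sum_congr rfl fun x _ => by ring
  rw [h', h, h]
  congr 1
  refine Finset.sum_congr rfl fun i _ => ?_
  rw [sum_mul_heatBath_mul hπ]
  exact Finset.sum_congr rfl fun x _ => by ring

theorem sum_mul_glauber (hn : 1 ≤ n) (hπ : ∀ x, 0 < π x) (f : (Fin n → Bool) → ℝ) :
    ∑ x, π x * glauber π f x = ∑ x, π x * f x := by
  have h := sum_mul_glauber_mul hπ f fun _ => 1
  simpa [glauber_one hn hπ] using h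

theorem sum_mul_glauber_sq_le (hn : 1 ≤ n) (hπ : ∀ x, 0 < π x) (f : (Fin n → Bool) → ℝ) :
    ∑ x, π x * glauber π f x ^ 2 ≤ ∑ x, π x * f x ^ 2 -
      1 / (2 * n) * ∑ i, ∑ x, flow π i x * (f x - f (flipAt i x)) ^ 2 := by
  have hn' : (0 : ℝ) < n := by positivity
  have hjensen : ∀ x, glauber π f x ^ 2 ≤ (1 / (n : ℝ)) * ∑ i, heatBath π i f x ^ 2 := by
    intro x
    have h := sq_sum_le_card_mul_sum_sq (s := (Finset.univ : Finset (Fin n)))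
      (f := fun i => heatBath π i f x)
    rw [Finset.card_univ, Fintype.card_fin] at h
    rw [glauber, mul_pow]
    calc (1 / (n : ℝ)) ^ 2 * (∑ i, heatBath π i f x) ^ 2
        ≤ (1 / (n : ℝ)) ^ 2 * (n * ∑ i, heatBath π i f x ^ 2) := by gcongr
      _ = _ := by field_simp
  calc ∑ x, π x * glauber π f x ^ 2
      ≤ ∑ x, π x * ((1 / (n : ℝ)) * ∑ i, heatBath π i f x ^ 2) :=
        Finset.sum_le_sum fun x _ => mul_le_mul_of_nonneg_left (hjensen x) (hπ x).le
    _ = (1 / (n : ℝ)) * ∑ i, ∑ x, π x * heatBath π i f x ^ 2 := by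
        rw [Finset.sum_comm, Finset.mul_sum]
        refine Finset.sum_congr rfl fun x _ => ?_
        rw [← Finset.mul_sum]
        ring
    _ = _ := by
        simp only [sum_mul_heatBath_sq hπ, Finset.sum_sub_distrib, ← Finset.mul_sum]
        simp only [Finset.sum_const, Finset.card_univ, Fintype.card_fin, nsmul_eq_mul]
        field_simp

end Reversible

/-- The `k`-th profile on the path from `x` to `y` that switches the players one by one in the
order `ℓ`. -/
def interpolate {n : ℕ} (ℓ : Equiv.Perm (Fin n)) (k : ℕ) (x y : Fin n → Bool) : Fin n → Bool :=
  fun u => if (ℓ u : ℕ) < k then y u else x u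

section Paths

variable {n : ℕ} {π : (Fin n → Bool) → ℝ} {ℓ : Equiv.Perm (Fin n)}

theorem interpolate_interpolate (k : ℕ) (x y : Fin n → Bool) :
    interpolate ℓ k (interpolate ℓ k x y) (interpolate ℓ k y x) = x := by
  funext u
  simp only [interpolate]
  split_ifs <;> rfl

theorem sum_comp_interpolate (k : ℕ) (F : (Fin n → Bool) → (Fin n → Bool) → ℝ) :
    ∑ x, ∑ y, F (interpolate ℓ k x y) (interpolate ℓ k y x) = ∑ x, ∑ y, F x y := by
  rw [← Fintype.sum_prod_type', ← Fintype.sum_prod_type']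
  exact Equiv.sum_comp (Function.Involutive.toPerm
    (fun p : (Fin n → Bool) × (Fin n → Bool) =>
      (interpolate ℓ k p.1 p.2, interpolate ℓ k p.2 p.1))
    fun p => by simp [interpolate_interpolate]) fun p => F p.1 p.2

theorem interpolate_apply_symm (k : Fin n) (x y : Fin n → Bool) :
    interpolate ℓ k x y (ℓ.symm k) = x (ℓ.symm k) := by
  simp [interpolate]

theorem interpolate_succ (k : Fin n) (x y : Fin n → Bool) :
    interpolate ℓ (k + 1) x y =
      Function.update (interpolate ℓ k x y) (ℓ.symm k) (y (ℓ.symm k)) := by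
  funext u
  rcases eq_or_ne u (ℓ.symm k) with rfl | hu
  · simp [interpolate]
  · have hk : (ℓ u : ℕ) ≠ k := fun h => hu (by rw [← Fin.ext h]; simp)
    rw [Function.update_of_ne hu]
    simp only [interpolate]
    congr 1
    apply propext
    omega

theorem interpolate_succ_of_eq (k : Fin n) {x y : Fin n → Bool}
    (h : x (ℓ.symm k) = y (ℓ.symm k)) :
    interpolate ℓ (k + 1) x y = interpolate ℓ k x y := by
  rw [interpolate_succ, ← h, ← interpolate_apply_symm (ℓ := ℓ) k x y, Function.update_eq_self]

theorem interpolate_succ_of_ne (k : Fin n) {x y : Fin n → Bool}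
    (h : x (ℓ.symm k) ≠ y (ℓ.symm k)) :
    interpolate ℓ (k + 1) x y = flipAt (ℓ.symm k) (interpolate ℓ k x y) := by
  have hy : y (ℓ.symm k) = !x (ℓ.symm k) := by
    revert h
    cases x (ℓ.symm k) <;> cases y (ℓ.symm k) <;> simp
  rw [interpolate_succ, flipAt, interpolate_apply_symm, hy]

theorem sum_ite_ne_add_flipAt (i : Fin n) (b : Bool) (F : (Fin n → Bool) → ℝ) :
    ∑ y, (if b ≠ y i then F y + F (flipAt i y) else 0) = ∑ y, F y := by
  refine sum_eq_sum_of_flipAt i fun y => ?_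
  rw [flipAt_flipAt, flipAt_apply_self]
  cases b <;> cases y i <;> simp [add_comm]

theorem sum_sq_step_le (hπ : ∀ x, 0 < π x) (hsum : ∑ x, π x = 1) {C : ℝ}
    (hC : ∀ k ≤ n, ∀ x y, π x * π y ≤
      C * (π (interpolate ℓ k x y) * π (interpolate ℓ k y x)))
    (f : (Fin n → Bool) → ℝ) (k : Fin n) :
    ∑ x, ∑ y, π x * π y *
        (f (interpolate ℓ (k + 1) x y) - f (interpolate ℓ k x y)) ^ 2 ≤
      C * ∑ x, flow π (ℓ.symm k) x * (f x - f (flipAt (ℓ.symm k) x)) ^ 2 := by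
  set v := ℓ.symm k with hv
  let T : (Fin n → Bool) → (Fin n → Bool) → ℝ := fun x y =>
    C * (flow π v x * (f x - f (flipAt v x)) ^ 2) *
      (if x v ≠ y v then π y + π (flipAt v y) else 0)
  have hT : ∀ x y, π x * π y *
      (f (interpolate ℓ (k + 1) x y) - f (interpolate ℓ k x y)) ^ 2 ≤
      T (interpolate ℓ k x y) (interpolate ℓ k y x) := by
    intro x y
    simp only [T]
    rw [interpolate_apply_symm, interpolate_apply_symm, ← hv]
    by_cases h : x v = y v
    · rw [interpolate_succ_of_eq k h]
      simp [h]
    · have h1 := hC k k.2.le x y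
      have h2 := hC (k + 1) k.2 x y
      rw [interpolate_succ_of_ne k h, interpolate_succ_of_ne k (Ne.symm h)] at h2
      rw [interpolate_succ_of_ne k h, if_pos h]
      rw [← hv] at h2 ⊢
      set ξ := interpolate ℓ k x y
      set η := interpolate ℓ k y x
      have hA := hπ ξ
      have hA' := hπ (flipAt v ξ)
      have hle : π x * π y ≤ C * flow π v ξ * (π η + π (flipAt v η)) := by
        have e : C * flow π v ξ * (π η + π (flipAt v η)) =
            (C * (π ξ * π η) * π (flipAt v ξ) +
              C * (π (flipAt v ξ) * π (flipAt v η)) * π ξ) / (π ξ + π (flipAt v ξ)) := by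
          simp only [flow]
          field_simp
        rw [e, le_div_iff₀ (by positivity)]
        nlinarith [mul_le_mul_of_nonneg_right h1 hA'.le, mul_le_mul_of_nonneg_right h2 hA.le]
      calc π x * π y * (f (flipAt v ξ) - f ξ) ^ 2
          ≤ C * flow π v ξ * (π η + π (flipAt v η)) * (f (flipAt v ξ) - f ξ) ^ 2 := by gcongr
        _ = _ := by ring
  calc _ ≤ ∑ x, ∑ y, T (interpolate ℓ k x y) (interpolate ℓ k y x) :=
        Finset.sum_le_sum fun x _ => Finset.sum_le_sum fun y _ => hT x y
    _ = ∑ x, ∑ y, T x y := sum_comp_interpolate (k : ℕ) T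
    _ = _ := by
        rw [Finset.mul_sum]
        refine Finset.sum_congr rfl fun x _ => ?_
        simp only [T]
        rw [← Finset.mul_sum, sum_ite_ne_add_flipAt, hsum, mul_one]

theorem sq_sub_le_path (f : (Fin n → Bool) → ℝ) (x y : Fin n → Bool) :
    (f y - f x) ^ 2 ≤
      n * ∑ k : Fin n, (f (interpolate ℓ (k + 1) x y) - f (interpolate ℓ k x y)) ^ 2 := by
  have htel : ∑ k : Fin n, (f (interpolate ℓ (k + 1) x y) - f (interpolate ℓ k x y)) =
      f y - f x := by
    rw [Fin.sum_univ_eq_sum_range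
      (fun k => f (interpolate ℓ (k + 1) x y) - f (interpolate ℓ k x y)) n,
      Finset.sum_range_sub (fun k => f (interpolate ℓ k x y))]
    have hy : interpolate ℓ n x y = y := by
      funext u
      simp [interpolate]
    have hx : interpolate ℓ 0 x y = x := by
      funext u
      simp [interpolate]
    rw [hy, hx]
  rw [← htel]
  simpa using sq_sum_le_card_mul_sum_sq (s := (Finset.univ : Finset (Fin n)))
    (f := fun k : Fin n => f (interpolate ℓ (k + 1) x y) - f (interpolate ℓ k x y))

theorem poincare_of_interpolate (hπ : ∀ x, 0 < π x) (hsum : ∑ x, π x = 1) {C : ℝ}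
    (hC : ∀ k ≤ n, ∀ x y, π x * π y ≤
      C * (π (interpolate ℓ k x y) * π (interpolate ℓ k y x)))
    (f : (Fin n → Bool) → ℝ) (hf : ∑ x, π x * f x = 0) :
    ∑ x, π x * f x ^ 2 ≤
      n * C / 2 * ∑ i, ∑ x, flow π i x * (f x - f (flipAt i x)) ^ 2 := by
  have hvar : ∑ x, ∑ y, π x * π y * (f y - f x) ^ 2 = 2 * ∑ x, π x * f x ^ 2 := by
    have h : ∀ x, ∑ y, π x * π y * (f y - f x) ^ 2 =
        π x * (∑ y, π y * f y ^ 2) - 2 * (π x * f x) * (∑ y, π y * f y) +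
          π x * f x ^ 2 * ∑ y, π y := fun x => by
      rw [Finset.mul_sum, Finset.mul_sum, Finset.mul_sum, ← Finset.sum_sub_distrib,
        ← Finset.sum_add_distrib]
      exact Finset.sum_congr rfl fun y _ => by ring
    simp only [h, hf, hsum, mul_zero, sub_zero, mul_one]
    rw [Finset.sum_add_distrib, ← Finset.sum_mul, hsum]
    ring
  have hle : ∑ x, ∑ y, π x * π y * (f y - f x) ^ 2 ≤
      n * ∑ k : Fin n, ∑ x, ∑ y, π x * π y *
        (f (interpolate ℓ (k + 1) x y) - f (interpolate ℓ k x y)) ^ 2 := by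
    have hcomm : ∑ k : Fin n, ∑ x, ∑ y, π x * π y *
        (f (interpolate ℓ (k + 1) x y) - f (interpolate ℓ k x y)) ^ 2 =
        ∑ x, ∑ y, π x * π y *
          ∑ k : Fin n, (f (interpolate ℓ (k + 1) x y) - f (interpolate ℓ k x y)) ^ 2 := by
      simp only [Finset.mul_sum]
      rw [Finset.sum_comm]
      exact Finset.sum_congr rfl fun x _ => Finset.sum_comm
    rw [hcomm, Finset.mul_sum]
    refine Finset.sum_le_sum fun x _ => ?_
    rw [Finset.mul_sum]
    refine Finset.sum_le_sum fun y _ => ?_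
    have := mul_le_mul_of_nonneg_left (sq_sub_le_path (ℓ := ℓ) f x y)
      (mul_pos (hπ x) (hπ y)).le
    linarith
  have hstep : ∑ k : Fin n, ∑ x, ∑ y, π x * π y *
        (f (interpolate ℓ (k + 1) x y) - f (interpolate ℓ k x y)) ^ 2 ≤
      C * ∑ i, ∑ x, flow π i x * (f x - f (flipAt i x)) ^ 2 := by
    rw [← Equiv.sum_comp ℓ.symm fun i => ∑ x, flow π i x * (f x - f (flipAt i x)) ^ 2,
      Finset.mul_sum]
    exact Finset.sum_le_sum fun k _ => sum_sq_step_le hπ hsum hC f k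
  have := mul_le_mul_of_nonneg_left hstep (Nat.cast_nonneg (α := ℝ) n)
  linarith

theorem sum_mul_glauber_sq_contract (hn : 1 ≤ n) (hπ : ∀ x, 0 < π x) (hsum : ∑ x, π x = 1)
    {C : ℝ} (hC0 : 0 < C)
    (hC : ∀ k ≤ n, ∀ x y, π x * π y ≤
      C * (π (interpolate ℓ k x y) * π (interpolate ℓ k y x)))
    (f : (Fin n → Bool) → ℝ) (hf : ∑ x, π x * f x = 0) :
    ∑ x, π x * glauber π f x ^ 2 ≤ Real.exp (-(1 / (n ^ 2 * C))) * ∑ x, π x * f x ^ 2 := by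
  have hn' : (0 : ℝ) < n := by positivity
  have h1 := sum_mul_glauber_sq_le hn hπ f
  have h2 := poincare_of_interpolate hπ hsum hC f hf
  set D := ∑ i, ∑ x, flow π i x * (f x - f (flipAt i x)) ^ 2
  set N := ∑ x, π x * f x ^ 2 with hN
  have hN0 : 0 ≤ N := Finset.sum_nonneg fun x _ => mul_nonneg (hπ x).le (sq_nonneg _)
  have h3 : 1 / (n ^ 2 * C) * N ≤ 1 / (2 * n) * D := by
    calc 1 / (n ^ 2 * C) * N ≤ 1 / (n ^ 2 * C) * (n * C / 2 * D) := by gcongr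
      _ = _ := by field_simp
  have h4 := mul_le_mul_of_nonneg_right (Real.add_one_le_exp (-(1 / (n ^ 2 * C)))) hN0
  linarith

theorem sum_mul_glauber_iterate_sq_le (hn : 1 ≤ n) (hπ : ∀ x, 0 < π x)
    (hsum : ∑ x, π x = 1) {C : ℝ} (hC0 : 0 < C)
    (hC : ∀ k ≤ n, ∀ x y, π x * π y ≤
      C * (π (interpolate ℓ k x y) * π (interpolate ℓ k y x)))
    (f : (Fin n → Bool) → ℝ) (hf : ∑ x, π x * f x = 0) (t : ℕ) :
    ∑ x, π x * (glauber π)^[t] f x ^ 2 ≤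
      Real.exp (-(t / (n ^ 2 * C))) * ∑ x, π x * f x ^ 2 := by
  induction t generalizing f with
  | zero => simp
  | succ t ih =>
    rw [Function.iterate_succ_apply]
    refine (ih (glauber π f) (by rw [sum_mul_glauber hn hπ, hf])).trans ?_
    calc _ ≤ Real.exp (-(t / (n ^ 2 * C))) *
          (Real.exp (-(1 / (n ^ 2 * C))) * ∑ x, π x * f x ^ 2) :=
        mul_le_mul_of_nonneg_left (sum_mul_glauber_sq_contract hn hπ hsum hC0 hC f hf)
          (Real.exp_pos _).le
      _ = _ := by
        rw [← mul_assoc, ← Real.exp_add]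
        congr 2
        push_cast
        ring

end Paths

section Logit

variable {n : ℕ}

theorem gibbsB_pos (β : ℝ) (Φ : (Fin n → Bool) → ℝ) (x : Fin n → Bool) :
    0 < gibbsB β Φ x :=
  div_pos (Real.exp_pos _) (Finset.sum_pos (fun _ _ => Real.exp_pos _) Finset.univ_nonempty)

theorem sum_gibbsB (β : ℝ) (Φ : (Fin n → Bool) → ℝ) : ∑ x, gibbsB β Φ x = 1 := by
  simp only [gibbsB]
  rw [← Finset.sum_div]
  exact div_self (Finset.sum_pos (fun _ _ => Real.exp_pos _) Finset.univ_nonempty).ne'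

theorem sigmaB_eq_gibbsB (β : ℝ) (Φ : (Fin n → Bool) → ℝ) (i : Fin n) (z : Bool)
    (x : Fin n → Bool) :
    sigmaB β Φ i z x = gibbsB β Φ (Function.update x i z) /
      (gibbsB β Φ x + gibbsB β Φ (flipAt i x)) := by
  have hZ : 0 < ∑ y : Fin n → Bool, Real.exp (-β * Φ y) :=
    Finset.sum_pos (fun _ _ => Real.exp_pos _) Finset.univ_nonempty
  rw [sigmaB, sum_bool_update i x fun y => Real.exp (-β * Φ y)]
  simp only [gibbsB]
  rw [← add_div, div_div_div_cancel_right₀ hZ.ne']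

theorem sum_ite_eq_update (i : Fin n) (x : Fin n → Bool) (g : Bool → ℝ)
    (f : (Fin n → Bool) → ℝ) :
    ∑ y : Fin n → Bool, (if y = Function.update x i (y i) then g (y i) else 0) * f y =
      ∑ z : Bool, g z * f (Function.update x i z) := by
  have h : ∀ y : Fin n → Bool, (if y = Function.update x i (y i) then g (y i) else 0) * f y =
      ∑ z : Bool, if y = Function.update x i z then g z * f y else 0 := fun y => by
    rw [Finset.sum_eq_single (y i)]
    · split_ifs <;> simp
    · intro z _ hz
      rw [if_neg]
      intro hy
      apply hz
      rw [hy]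
      simp
    · simp
  simp only [h]
  rw [Finset.sum_comm]
  simp

theorem logitPB_mulVec (β : ℝ) (Φ : (Fin n → Bool) → ℝ) (f : (Fin n → Bool) → ℝ) :
    Matrix.mulVec (logitPB β Φ) f = glauber (gibbsB β Φ) f := by
  funext x
  simp only [Matrix.mulVec, dotProduct, logitPB, glauber, mul_assoc]
  rw [← Finset.mul_sum]
  congr 1
  simp only [Finset.sum_mul]
  rw [Finset.sum_comm]
  refine Finset.sum_congr rfl fun i _ => ?_
  rw [sum_ite_eq_update i x (fun z => sigmaB β Φ i z x) f]
  simp only [sigmaB_eq_gibbsB]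
  rw [sum_bool_update i x fun y =>
    gibbsB β Φ y / (gibbsB β Φ x + gibbsB β Φ (flipAt i x)) * f y, heatBath]
  ring

theorem logitPB_pow_mulVec (β : ℝ) (Φ : (Fin n → Bool) → ℝ) (f : (Fin n → Bool) → ℝ) (t : ℕ) :
    Matrix.mulVec (logitPB β Φ ^ t) f = (glauber (gibbsB β Φ))^[t] f := by
  induction t generalizing f with
  | zero => simp
  | succ t ih => rw [pow_succ, ← Matrix.mulVec_mulVec, logitPB_mulVec, ih,
      Function.iterate_succ_apply]

theorem sum_mul_glauber_iterate_mul {π : (Fin n → Bool) → ℝ} (hπ : ∀ x, 0 < π x)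
    (f g : (Fin n → Bool) → ℝ) (t : ℕ) :
    ∑ x, π x * ((glauber π)^[t] f x * g x) = ∑ x, π x * (f x * (glauber π)^[t] g x) := by
  induction t generalizing f with
  | zero => rfl
  | succ t ih =>
    rw [Function.iterate_succ_apply, ih, sum_mul_glauber_mul hπ, Function.iterate_succ_apply']

/-- Reversibility: the density of the law at time `t` with respect to the Gibbs measure is obtained
by evolving the initial density. -/
theorem logitPB_pow_apply (β : ℝ) (Φ : (Fin n → Bool) → ℝ) (t : ℕ) (x y : Fin n → Bool) :
    (logitPB β Φ ^ t) x y = gibbsB β Φ y *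
      (glauber (gibbsB β Φ))^[t] (Pi.single x (gibbsB β Φ x)⁻¹) y := by
  have hx := (gibbsB_pos β Φ x).ne'
  have h := sum_mul_glauber_iterate_mul (gibbsB_pos β Φ) (Pi.single x (gibbsB β Φ x)⁻¹)
    (Pi.single y 1) t
  rw [← logitPB_pow_mulVec β Φ (Pi.single y 1), Matrix.mulVec_single_one,
    Finset.sum_eq_single y (by intro z _ hz; simp [hz]) (by simp),
    Finset.sum_eq_single x (by intro z _ hz; simp [hz]) (by simp)] at h
  rw [Pi.single_eq_same, Pi.single_eq_same, mul_one, mul_inv_cancel_left₀ hx] at h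
  exact h.symm

theorem glauber_iterate_sub_one {π : (Fin n → Bool) → ℝ} (hn : 1 ≤ n) (hπ : ∀ x, 0 < π x)
    (f : (Fin n → Bool) → ℝ) (t : ℕ) :
    (glauber π)^[t] (f - fun _ => 1) = (glauber π)^[t] f - fun _ => 1 := by
  induction t generalizing f with
  | zero => rfl
  | succ t ih =>
    rw [Function.iterate_succ_apply, Function.iterate_succ_apply, glauber_sub,
      glauber_one hn hπ, ih]

theorem sum_mul_single_inv_sub_one_sq {π : (Fin n → Bool) → ℝ} (hπ : ∀ x, 0 < π x)
    (hsum : ∑ x, π x = 1) (x : Fin n → Bool) :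
    ∑ y, π y * ((Pi.single x (π x)⁻¹ - fun _ => 1 : (Fin n → Bool) → ℝ) y) ^ 2 =
      (π x)⁻¹ - 1 := by
  have hx := (hπ x).ne'
  have h : ∀ y, π y * ((Pi.single x (π x)⁻¹ - fun _ => 1 : (Fin n → Bool) → ℝ) y) ^ 2 =
      (if y = x then (π x)⁻¹ - 2 else 0) + π y := fun y => by
    rw [Pi.sub_apply, Pi.single_apply]
    split_ifs with hy
    · subst hy
      field_simp
      ring
    · ring
  simp only [h, Finset.sum_add_distrib, hsum, Finset.sum_ite_eq', Finset.mem_univ, if_true]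
  ring

theorem tvDist_logitPB_le (hn : 1 ≤ n) (β : ℝ) (Φ : (Fin n → Bool) → ℝ)
    {ℓ : Equiv.Perm (Fin n)} {C : ℝ} (hC0 : 0 < C)
    (hC : ∀ k ≤ n, ∀ x y, gibbsB β Φ x * gibbsB β Φ y ≤
      C * (gibbsB β Φ (interpolate ℓ k x y) * gibbsB β Φ (interpolate ℓ k y x)))
    (t : ℕ) (x : Fin n → Bool) :
    tvDist ((logitPB β Φ ^ t) x) (gibbsB β Φ) ^ 2 ≤
      Real.exp (-(t / (n ^ 2 * C))) * (gibbsB β Φ x)⁻¹ := by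
  set π := gibbsB β Φ with hπdef
  have hπ : ∀ x, 0 < π x := gibbsB_pos β Φ
  have hsum : ∑ x, π x = 1 := sum_gibbsB β Φ
  have hx := (hπ x).ne'
  set g : (Fin n → Bool) → ℝ := Pi.single x (π x)⁻¹ - fun _ => 1 with hg
  have hg0 : ∑ y, π y * g y = 0 := by
    simp [hg, mul_sub, Pi.single_apply, hsum, hx]
  have htv : tvDist ((logitPB β Φ ^ t) x) π =
      1 / 2 * ∑ y, π y * |(glauber π)^[t] g y| := by
    rw [tvDist]
    congr 1
    refine Finset.sum_congr rfl fun y _ => ?_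
    rw [logitPB_pow_apply, hg, glauber_iterate_sub_one hn hπ, Pi.sub_apply, ← hπdef,
      ← abs_of_pos (hπ y), ← abs_mul, abs_of_pos (hπ y)]
    congr 1
    ring
  have hcs : (∑ y, π y * |(glauber π)^[t] g y|) ^ 2 ≤ ∑ y, π y * (glauber π)^[t] g y ^ 2 := by
    have h := Finset.sum_mul_sq_le_sq_mul_sq Finset.univ (fun y => √(π y))
      (fun y => √(π y) * |(glauber π)^[t] g y|)
    simpa only [← mul_assoc, mul_pow, Real.sq_sqrt (hπ _).le, sq_abs, hsum, one_mul,
      Real.mul_self_sqrt (hπ _).le] using h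
  have hdec := sum_mul_glauber_iterate_sq_le hn hπ hsum hC0 hC g hg0 t
  have hnorm : ∑ y, π y * g y ^ 2 = (π x)⁻¹ - 1 := sum_mul_single_inv_sub_one_sq hπ hsum x
  rw [hnorm] at hdec
  have hexp := Real.exp_pos (-(t / (n ^ 2 * C)))
  rw [htv, mul_pow]
  nlinarith [sq_nonneg (∑ y, π y * |(glauber π)^[t] g y|)]

end Logit

section Coordination

variable {n : ℕ} {E : Finset (Fin n × Fin n)} {δ0 δ1 : ℝ}

theorem exists_ordering_card_crossEdges_le (E : Finset (Fin n × Fin n)) :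
    ∃ ℓ : Equiv.Perm (Fin n), ∀ i, (crossEdges E ℓ i).card ≤ cutwidth E := by
  obtain ⟨ℓ, -, h⟩ := Finset.exists_mem_eq_inf' ⟨Equiv.refl (Fin n), Finset.mem_univ _⟩
    fun ℓ : Equiv.Perm (Fin n) => Finset.univ.sup fun i => (crossEdges E ℓ i).card
  refine ⟨ℓ, fun i => ?_⟩
  rw [cutwidth, h]
  exact Finset.le_sup (f := fun i => (crossEdges E ℓ i).card) (Finset.mem_univ i)

theorem card_filter_cut_le {ℓ : Equiv.Perm (Fin n)}
    (hℓ : ∀ i, (crossEdges E ℓ i).card ≤ cutwidth E) {k : ℕ} (hk : k ≤ n) :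
    (E.filter fun e => ¬((ℓ e.1 : ℕ) < k ↔ (ℓ e.2 : ℕ) < k)).card ≤ cutwidth E := by
  rcases k with _ | k
  · simp
  · refine le_trans (Finset.card_le_card fun e he => ?_) (hℓ (ℓ.symm ⟨k, hk⟩))
    rw [Finset.mem_filter] at he
    rw [crossEdges, Finset.mem_filter, Equiv.apply_symm_apply, min_le_iff, lt_max_iff]
    simp only [Fin.le_def, Fin.lt_def]
    refine ⟨he.1, ?_⟩
    have := he.2
    omega

theorem coordPhi_exchange (h0 : 0 ≤ δ0) (h1 : 0 ≤ δ1) (a b c d : Bool) :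
    coordPhi δ0 δ1 a d + coordPhi δ0 δ1 c b - (coordPhi δ0 δ1 a b + coordPhi δ0 δ1 c d) ≤
      δ0 + δ1 := by
  cases a <;> cases b <;> cases c <;> cases d <;> simp [coordPhi] <;> linarith

theorem graphPot_interpolate_le (h0 : 0 ≤ δ0) (h1 : 0 ≤ δ1) {ℓ : Equiv.Perm (Fin n)}
    (hℓ : ∀ i, (crossEdges E ℓ i).card ≤ cutwidth E) {k : ℕ} (hk : k ≤ n)
    (x y : Fin n → Bool) :
    graphPot E δ0 δ1 (interpolate ℓ k x y) + graphPot E δ0 δ1 (interpolate ℓ k y x) -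
      (graphPot E δ0 δ1 x + graphPot E δ0 δ1 y) ≤ cutwidth E * (δ0 + δ1) := by
  simp only [graphPot]
  rw [← Finset.sum_add_distrib, ← Finset.sum_add_distrib, ← Finset.sum_sub_distrib]
  calc _ ≤ ∑ e ∈ E, if ¬((ℓ e.1 : ℕ) < k ↔ (ℓ e.2 : ℕ) < k) then δ0 + δ1 else 0 := by
        refine Finset.sum_le_sum fun e _ => ?_
        simp only [interpolate]
        have ha := coordPhi_exchange h0 h1 (x e.1) (x e.2) (y e.1) (y e.2)
        have hb := coordPhi_exchange h0 h1 (y e.1) (y e.2) (x e.1) (x e.2)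
        by_cases hu : (ℓ e.1 : ℕ) < k <;> by_cases hv : (ℓ e.2 : ℕ) < k <;> simp [hu, hv] <;>
          linarith
    _ = (E.filter fun e => ¬((ℓ e.1 : ℕ) < k ↔ (ℓ e.2 : ℕ) < k)).card * (δ0 + δ1) := by
        rw [← Finset.sum_filter, Finset.sum_const, nsmul_eq_mul]
    _ ≤ _ := by
        have := card_filter_cut_le hℓ hk
        gcongr

theorem gibbsB_mul_gibbsB_le (h0 : 0 ≤ δ0) (h1 : 0 ≤ δ1) {β : ℝ} (hβ : 0 ≤ β)
    {ℓ : Equiv.Perm (Fin n)} (hℓ : ∀ i, (crossEdges E ℓ i).card ≤ cutwidth E) {k : ℕ}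
    (hk : k ≤ n) (x y : Fin n → Bool) :
    gibbsB β (graphPot E δ0 δ1) x * gibbsB β (graphPot E δ0 δ1) y ≤
      Real.exp (cutwidth E * (δ0 + δ1) * β) *
        (gibbsB β (graphPot E δ0 δ1) (interpolate ℓ k x y) *
          gibbsB β (graphPot E δ0 δ1) (interpolate ℓ k y x)) := by
  simp only [gibbsB]
  rw [div_mul_div_comm, div_mul_div_comm, ← mul_div_assoc, ← Real.exp_add, ← Real.exp_add,
    ← Real.exp_add]
  refine div_le_div_of_nonneg_right (Real.exp_le_exp.mpr ?_)
    (mul_nonneg (Finset.sum_nonneg fun _ _ => (Real.exp_pos _).le)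
      (Finset.sum_nonneg fun _ _ => (Real.exp_pos _).le))
  nlinarith [mul_le_mul_of_nonneg_left (graphPot_interpolate_le h0 h1 hℓ hk x y) hβ]

theorem graphPot_nonpos (h0 : 0 ≤ δ0) (h1 : 0 ≤ δ1) (x : Fin n → Bool) :
    graphPot E δ0 δ1 x ≤ 0 := by
  refine Finset.sum_nonpos fun e _ => ?_
  rw [coordPhi]
  split_ifs <;> linarith

theorem neg_le_graphPot (h01 : δ1 ≤ δ0) (h1 : 0 ≤ δ1) (x : Fin n → Bool) :
    -(n ^ 2 * δ0) ≤ graphPot E δ0 δ1 x := by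
  have hE : (E.card : ℝ) ≤ n ^ 2 := by
    have := Finset.card_le_univ E
    rw [Fintype.card_prod, Fintype.card_fin, ← sq] at this
    exact_mod_cast this
  have h : ∑ _e ∈ E, -δ0 ≤ graphPot E δ0 δ1 x := by
    refine Finset.sum_le_sum fun e _ => ?_
    rw [coordPhi]
    split_ifs <;> linarith
  rw [Finset.sum_const, nsmul_eq_mul] at h
  nlinarith

theorem inv_gibbsB_le (h01 : δ1 ≤ δ0) (h1 : 0 ≤ δ1) {β : ℝ} (hβ : 0 ≤ β)
    (x : Fin n → Bool) :
    (gibbsB β (graphPot E δ0 δ1) x)⁻¹ ≤ Real.exp (n * (n * δ0 * β + 1)) := by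
  have hx : 1 ≤ Real.exp (-β * graphPot E δ0 δ1 x) :=
    Real.one_le_exp (by nlinarith [graphPot_nonpos (E := E) (h1.trans h01) h1 x])
  have hZ : ∑ y : Fin n → Bool, Real.exp (-β * graphPot E δ0 δ1 y) ≤
      2 ^ n * Real.exp (n ^ 2 * δ0 * β) := by
    calc _ ≤ ∑ _y : Fin n → Bool, Real.exp (n ^ 2 * δ0 * β) :=
          Finset.sum_le_sum fun y _ => Real.exp_le_exp.mpr
            (by nlinarith [neg_le_graphPot (E := E) h01 h1 y])
      _ = _ := by simp
  have h2 : (2 : ℝ) ^ n ≤ Real.exp n := by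
    rw [← Real.exp_one_pow]
    exact pow_le_pow_left₀ (by norm_num) (by linarith [Real.add_one_le_exp 1]) n
  rw [gibbsB, inv_div]
  calc _ ≤ ∑ y : Fin n → Bool, Real.exp (-β * graphPot E δ0 δ1 y) :=
        div_le_self (Finset.sum_nonneg fun _ _ => (Real.exp_pos _).le) hx
    _ ≤ Real.exp n * Real.exp (n ^ 2 * δ0 * β) := hZ.trans (by gcongr)
    _ = _ := by
        rw [← Real.exp_add]
        ring_nf

end Coordination

/-- For an `n`-player graphical coordination game on a graph with
edge set `E` and parameters `δ₀ ≥ δ₁ > 0`, after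
`t ≥ 2·n²·e^{χ(G)·(δ₀+δ₁)·β}·(ln(1/ε) + n·(n·δ₀·β + 1))` steps the logit dynamics with
inverse noise `β ≥ 0` is within total variation distance `ε` of the Gibbs measure, from
every starting profile; in particular `t_mix ≤ 2·n³·e^{χ(G)·(δ₀+δ₁)·β}·(n·δ₀·β + 1)` up
to an absolute constant factor. -/
theorem graphical_coordination_mixing_cutwidth
    (n : ℕ) (hn : 1 ≤ n) (E : Finset (Fin n × Fin n))
    (horient : ∀ e ∈ E, e.1 < e.2)
    (δ0 δ1 : ℝ) (h01 : δ1 ≤ δ0) (h1 : 0 < δ1) (β : ℝ) (hβ : 0 ≤ β) :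
    ∀ ε : ℝ, 0 < ε → ε < 1 → ∀ t : ℕ,
      2 * (n : ℝ) ^ 2 * Real.exp ((cutwidth E : ℝ) * (δ0 + δ1) * β) *
          (Real.log (1 / ε) + (n : ℝ) * ((n : ℝ) * δ0 * β + 1)) ≤ (t : ℝ) →
      ∀ x : Fin n → Bool,
        tvDist ((logitPB β (graphPot E δ0 δ1) ^ t) x)
          (gibbsB β (graphPot E δ0 δ1)) ≤ ε := by
  intro ε hε _ t ht x
  obtain ⟨ℓ, hℓ⟩ := exists_ordering_card_crossEdges_le E
  have h0 : 0 ≤ δ0 := h1.le.trans h01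
  have hn' : (0 : ℝ) < n := by positivity
  set C := Real.exp ((cutwidth E : ℝ) * (δ0 + δ1) * β) with hCdef
  have hC0 : 0 < C := Real.exp_pos _
  have htv := tvDist_logitPB_le hn β (graphPot E δ0 δ1) hC0
    (fun k hk => gibbsB_mul_gibbsB_le h0 h1.le hβ hℓ hk) t x
  have hinv := inv_gibbsB_le (E := E) h01 h1.le hβ x
  set R := (n : ℝ) * (n * δ0 * β + 1)
  have hR : 0 ≤ R := by positivity
  have hrate : 2 * (Real.log (1 / ε) + R) ≤ t / (n ^ 2 * C) := by
    rw [le_div_iff₀ (by positivity)]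
    linarith
  rw [one_div, Real.log_inv] at hrate
  refine le_of_sq_le_sq ?_ hε.le
  calc _ ≤ Real.exp (-(t / (n ^ 2 * C))) * Real.exp R :=
        htv.trans (mul_le_mul_of_nonneg_left hinv (Real.exp_pos _).le)
    _ ≤ Real.exp (Real.log ε + Real.log ε) := by
        rw [← Real.exp_add]
        exact Real.exp_le_exp.mpr (by linarith)
    _ = ε ^ 2 := by rw [Real.exp_add, Real.exp_log hε, sq]
end
end
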